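/- In the two-qubit entanglement swapping setup, the average post-measurement entropy and concurrence satisfy ∑_{i : p_i>0} p_i · S(ρⁱ) ≤ ∑_{i : p_i>0} p_i · C(ρⁱ) ≤ 4·|a0·a1|·|b0·b1|, where C(ρ) := sqrt(2·((tr ρ)² − tr(ρ²))). -/

import Mathlib

open Classical

/-- Von Neumann entropy (natural log) of a matrix, via the eigenvalues of a
Hermitian matrix; junk value 0 for non-Hermitian matrices. -/
noncomputable def vnEntropy {n : Type*} [Fintype n] [DecidableEq n] (ρ : Matrix n n ℂ) : ℝ :=
  if h : ρ.IsHermitian then ∑ i, Real.negMulLog (h.eigenvalues i) else 0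

/-- Concurrence C(ρ) = sqrt(2·((tr ρ)² − tr(ρ²))) of a matrix (real part of the
traces; for Hermitian matrices the traces are real). -/
noncomputable def conc {n : Type*} [Fintype n] (ρ : Matrix n n ℂ) : ℝ :=
  Real.sqrt (2 * (((Matrix.trace ρ).re) ^ 2 - (Matrix.trace (ρ * ρ)).re))

theorem Matrix.IsHermitian.conc_eq_two_mul_sqrt_det {ρ : Matrix (Fin 2) (Fin 2) ℂ}
    (h : ρ.IsHermitian) : conc ρ = 2 * √(ρ.det.re) := by
  have h00 : (ρ 0 0).im = 0 := by
    have := congrArg Complex.im (h.apply 0 0)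
    simp at this
    linarith
  have h11 : (ρ 1 1).im = 0 := by
    have := congrArg Complex.im (h.apply 1 1)
    simp at this
    linarith
  have key : 2 * ((ρ.trace.re) ^ 2 - ((ρ * ρ).trace).re) = 2 ^ 2 * ρ.det.re := by
    simp [Matrix.trace_fin_two, Matrix.det_fin_two, Matrix.mul_apply, Fin.sum_univ_two, h00, h11]
    ring
  rw [conc, key, Real.sqrt_mul (by norm_num), Real.sqrt_sq (by norm_num)]

theorem conc_mul_conjTranspose (M : Matrix (Fin 2) (Fin 2) ℂ) :
    conc (M * M.conjTranspose) = 2 * ‖M.det‖ := by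
  have hdet : (M * M.conjTranspose).det.re = ‖M.det‖ ^ 2 := by
    rw [Matrix.det_mul, Matrix.det_conjTranspose, Complex.star_def, Complex.mul_conj,
      Complex.ofReal_re, Complex.normSq_eq_norm_sq]
  rw [(Matrix.isHermitian_mul_conjTranspose_self M).conc_eq_two_mul_sqrt_det, hdet,
    Real.sqrt_sq (norm_nonneg _)]

theorem Real.negMulLog_le_two_mul_sqrt_sub {x : ℝ} (hx : 0 ≤ x) :
    Real.negMulLog x ≤ 2 * (√x - x) := by
  rcases hx.eq_or_lt with rfl | hx
  · simp
  have hs : 0 < √x := Real.sqrt_pos.2 hx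
  have hlog := Real.one_sub_inv_le_log_of_pos hs
  rw [Real.log_sqrt hx.le] at hlog
  have hmul := mul_le_mul_of_nonneg_left hlog hx.le
  have hinv : x * (√x)⁻¹ = √x := by
    rw [← div_eq_mul_inv, Real.div_sqrt]
  rw [mul_sub, hinv] at hmul
  rw [Real.negMulLog]
  linarith

theorem Real.negMulLog_add_negMulLog_le {x y : ℝ} (hx : 0 ≤ x) (hy : 0 ≤ y) (h : x + y = 1) :
    Real.negMulLog x + Real.negMulLog y ≤ 2 * √(x * y) := by
  have hx1 : √x ≤ 1 := Real.sqrt_le_one.2 (by linarith)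
  have hy1 : √y ≤ 1 := Real.sqrt_le_one.2 (by linarith)
  rw [Real.sqrt_mul hx]
  linarith [Real.negMulLog_le_two_mul_sqrt_sub hx, Real.negMulLog_le_two_mul_sqrt_sub hy,
    mul_nonneg (sub_nonneg.2 hx1) (sub_nonneg.2 hy1)]

open scoped ComplexOrder in
theorem Matrix.PosSemidef.vnEntropy_le_conc {ρ : Matrix (Fin 2) (Fin 2) ℂ}
    (h : ρ.PosSemidef) (htr : ρ.trace = 1) : vnEntropy ρ ≤ conc ρ := by
  have hH := h.isHermitian
  have hsum : hH.eigenvalues 0 + hH.eigenvalues 1 = 1 := by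
    have := hH.trace_eq_sum_eigenvalues
    rw [htr, Fin.sum_univ_two] at this
    simpa using (congrArg Complex.re this).symm
  have hdet : ρ.det.re = hH.eigenvalues 0 * hH.eigenvalues 1 := by
    rw [hH.det_eq_prod_eigenvalues, Fin.prod_univ_two]
    simp
  rw [hH.conc_eq_two_mul_sqrt_det, hdet, vnEntropy, dif_pos hH, Fin.sum_univ_two]
  exact Real.negMulLog_add_negMulLog_le (h.eigenvalues_nonneg 0) (h.eigenvalues_nonneg 1) hsum

open scoped ComplexOrder in
theorem vnEntropy_mul_conjTranspose_le_conc {M : Matrix (Fin 2) (Fin 2) ℂ}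
    (htr : (M * M.conjTranspose).trace = 1) :
    vnEntropy (M * M.conjTranspose) ≤ conc (M * M.conjTranspose) :=
  (Matrix.posSemidef_self_mul_conjTranspose M).vnEntropy_le_conc htr

theorem Matrix.two_mul_norm_det_fin_two_le (M : Matrix (Fin 2) (Fin 2) ℂ) :
    2 * ‖M.det‖ ≤ ‖M 0 0‖ ^ 2 + ‖M 0 1‖ ^ 2 + ‖M 1 0‖ ^ 2 + ‖M 1 1‖ ^ 2 := by
  have h := norm_sub_le (M 0 0 * M 1 1) (M 0 1 * M 1 0)
  rw [← Matrix.det_fin_two, norm_mul, norm_mul] at h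
  linarith [sq_nonneg (‖M 0 0‖ - ‖M 1 1‖), sq_nonneg (‖M 0 1‖ - ‖M 1 0‖)]

/-- A square-root factor `M` of the post-measurement state `M * Mᴴ` of outcome vector `v`,
occurring with probability `p`. -/
noncomputable def swapFactor (a b : Fin 2 → ℂ) (v : Fin 2 × Fin 2 → ℂ) (p : ℝ) :
    Matrix (Fin 2) (Fin 2) ℂ :=
  Matrix.of fun k m => ((√p)⁻¹ : ℝ) * (a k * (starRingEnd ℂ) (v (k, m)) * (‖b m‖ : ℝ))

theorem swapFactor_mul_conjTranspose_apply (a b : Fin 2 → ℂ) (v : Fin 2 × Fin 2 → ℂ) {p : ℝ}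
    (hp : 0 ≤ p) (k k' : Fin 2) :
    (swapFactor a b v p * (swapFactor a b v p).conjTranspose) k k' =
      (p : ℂ)⁻¹ * (a k * (starRingEnd ℂ) (a k') *
        ∑ m : Fin 2, (starRingEnd ℂ) (v (k, m)) * v (k', m) * ((‖b m‖ ^ 2 : ℝ) : ℂ)) := by
  have hc : (p : ℂ)⁻¹ = (((√p)⁻¹ : ℝ) : ℂ) * (((√p)⁻¹ : ℝ) : ℂ) := by
    rw [← Complex.ofReal_mul, ← mul_inv, Real.mul_self_sqrt hp, Complex.ofReal_inv]
  rw [hc]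
  simp only [Matrix.mul_apply, Matrix.conjTranspose_apply, swapFactor, Matrix.of_apply,
    Fin.sum_univ_two, Complex.star_def, map_mul, Complex.conj_ofReal, Complex.conj_conj,
    Complex.ofReal_pow]
  ring

theorem norm_det_swapFactor (a b : Fin 2 → ℂ) (v : Fin 2 × Fin 2 → ℂ) {p : ℝ} (hp : 0 ≤ p) :
    ‖(swapFactor a b v p).det‖ =
      p⁻¹ * (‖a 0 * a 1‖ * ‖b 0 * b 1‖ * ‖(Matrix.of fun k m => v (k, m)).det‖) := by
  have hdet : (swapFactor a b v p).det =
      ((((√p)⁻¹ * (√p)⁻¹ : ℝ)) : ℂ) * ((a 0 * a 1) * ((‖b 0 * b 1‖ : ℝ) : ℂ) *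
        (starRingEnd ℂ) (Matrix.of fun k m => v (k, m)).det) := by
    simp only [Matrix.det_fin_two, swapFactor, Matrix.of_apply, norm_mul, map_sub, map_mul,
      Complex.ofReal_mul]
    ring
  rw [hdet, ← mul_inv, Real.mul_self_sqrt hp]
  simp only [norm_mul, Complex.norm_real, RCLike.norm_conj, norm_inv, norm_norm,
    Real.norm_of_nonneg hp]

theorem trace_swapFactor_mul_conjTranspose (a b : Fin 2 → ℂ) (v : Fin 2 × Fin 2 → ℂ) {p : ℝ}
    (hp : p = ∑ x : Fin 2 × Fin 2, ‖v x‖ ^ 2 * ‖a x.1‖ ^ 2 * ‖b x.2‖ ^ 2) (hpos : 0 < p) :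
    (swapFactor a b v p * (swapFactor a b v p).conjTranspose).trace = 1 := by
  have hne : (p : ℂ) ≠ 0 := by exact_mod_cast hpos.ne'
  rw [Matrix.trace_fin_two, swapFactor_mul_conjTranspose_apply a b v hpos.le,
    swapFactor_mul_conjTranspose_apply a b v hpos.le, ← mul_add, inv_mul_eq_one₀ hne, hp]
  simp only [Fintype.sum_prod_type, Fin.sum_univ_two, Complex.mul_conj', Complex.conj_mul']
  push_cast
  ring

/-- Average post-measurement entropy is bounded by average concurrence, which is
bounded by 4·|a0·a1|·|b0·b1|, in the two-qubit entanglement swapping setup. -/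
theorem avg_entropy_le_avg_concurrence_le
    (a b : Fin 2 → ℂ)
    (ha : ‖a 0‖ ^ 2 + ‖a 1‖ ^ 2 = 1) (hb : ‖b 0‖ ^ 2 + ‖b 1‖ ^ 2 = 1)
    (u : Fin 4 → Fin 2 × Fin 2 → ℂ)
    (hu : ∀ i j : Fin 4,
      ∑ x : Fin 2 × Fin 2, (starRingEnd ℂ) (u i x) * u j x = if i = j then 1 else 0)
    (p : Fin 4 → ℝ)
    (hp : ∀ i, p i = ∑ x : Fin 2 × Fin 2, ‖u i x‖ ^ 2 * ‖a x.1‖ ^ 2 * ‖b x.2‖ ^ 2)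
    (ρ : Fin 4 → Matrix (Fin 2) (Fin 2) ℂ)
    (hρ : ∀ i, ∀ k k' : Fin 2, ρ i k k' = ((p i : ℝ) : ℂ)⁻¹ *
      (a k * (starRingEnd ℂ) (a k') *
        ∑ m : Fin 2, (starRingEnd ℂ) (u i (k, m)) * u i (k', m) * ((‖b m‖ ^ 2 : ℝ) : ℂ))) :
    (∑ i ∈ Finset.univ.filter (fun i => 0 < p i), p i * vnEntropy (ρ i) ≤
      ∑ i ∈ Finset.univ.filter (fun i => 0 < p i), p i * conc (ρ i)) ∧
    (∑ i ∈ Finset.univ.filter (fun i => 0 < p i), p i * conc (ρ i) ≤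
      4 * (‖a 0 * a 1‖ * ‖b 0 * b 1‖)) := by
  have hfactor : ∀ i, 0 < p i →
      ρ i = swapFactor a b (u i) (p i) * (swapFactor a b (u i) (p i)).conjTranspose := by
    intro i hi
    ext k k'
    rw [hρ, swapFactor_mul_conjTranspose_apply a b (u i) hi.le]
  refine ⟨Finset.sum_le_sum fun i hi => ?_, ?_⟩
  · have hi : 0 < p i := (Finset.mem_filter.1 hi).2
    refine mul_le_mul_of_nonneg_left ?_ hi.le
    rw [hfactor i hi]
    exact vnEntropy_mul_conjTranspose_le_conc
      (trace_swapFactor_mul_conjTranspose a b (u i) (hp i) hi)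
  have hK : 0 ≤ ‖a 0 * a 1‖ * ‖b 0 * b 1‖ := by positivity
  have hdet : ∀ i, 2 * ‖(Matrix.of fun k m => u i (k, m)).det‖ ≤ 1 := by
    intro i
    refine (Matrix.two_mul_norm_det_fin_two_le _).trans_eq ?_
    have h := hu i i
    simp only [Complex.conj_mul', if_true, Fintype.sum_prod_type, Fin.sum_univ_two] at h
    norm_cast at h
    simp only [Matrix.of_apply]
    linarith
  have hterm : ∀ i, 0 < p i → p i * conc (ρ i) ≤ ‖a 0 * a 1‖ * ‖b 0 * b 1‖ := by
    intro i hi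
    rw [hfactor i hi, conc_mul_conjTranspose, norm_det_swapFactor a b (u i) hi.le,
      mul_left_comm, mul_inv_cancel_left₀ hi.ne']
    linarith [mul_le_mul_of_nonneg_left (hdet i) hK]
  refine (Finset.sum_le_card_nsmul _ _ _ fun i hi => hterm i (Finset.mem_filter.1 hi).2).trans ?_
  rw [nsmul_eq_mul]
  refine mul_le_mul_of_nonneg_right ?_ hK
  exact_mod_cast Finset.card_le_univ (Finset.univ.filter fun i => 0 < p i)
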